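/- Let T be a tournament on players v_1, …, v_n with n a power of two, and let Q be the n×n column-stochastic matrix with Q_{ij} = 1/n if v_i beats v_j, Q_{ij} = 0 if v_j beats v_i (i ≠ j), and Q_{ii} = (out(v_i) + 1)/n. If p is a probability vector (nonnegative entries summing to 1) satisfying Qp = p, then every player v_i whose entry p_i is maximal among all entries of p is an SE winner of T. -/

import Mathlib

/-- A tournament relation on `V`: irreflexive, asymmetric, and total. -/
structure IsTournament {V : Type*} (beats : V → V → Prop) : Prop where
  irrefl : ∀ v, ¬ beats v v
  asymm : ∀ u v, beats u v → ¬ beats v u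
  total : ∀ u v, u ≠ v → beats u v ∨ beats v u

/-- `SEWinner beats S v` : the player `v` can win a balanced single-elimination
tournament among the players of `S` under some seeding.  Either `S = {v}`, or `S`
can be partitioned into pairs (via a fixed-point-free involution `f` of `S`) such
that `v` is an SE winner of the set `W` of winners of the pairs. -/
inductive SEWinner {V : Type*} (beats : V → V → Prop) : Finset V → V → Prop
  | single (v : V) : SEWinner beats {v} v
  | round (S W : Finset V) (f : V → V) (v : V)
      (hf : ∀ x ∈ S, f x ∈ S ∧ f x ≠ x ∧ f (f x) = x)
      (hW : ∀ x, x ∈ W ↔ x ∈ S ∧ beats x (f x))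
      (hw : SEWinner beats W v) : SEWinner beats S v

/-- A king: every other player is beaten by `v` or by someone `v` beats. -/
def IsKing {V : Type*} (beats : V → V → Prop) (v : V) : Prop :=
  ∀ u, u ≠ v → beats v u ∨ ∃ w, beats v w ∧ beats w u

/-- A 3-king: every other player is reachable from `v` in at most 3 steps. -/
def IsThreeKing {V : Type*} (beats : V → V → Prop) (v : V) : Prop :=
  ∀ u, u ≠ v → beats v u ∨ (∃ w, beats v w ∧ beats w u) ∨
    ∃ w x, beats v w ∧ beats w x ∧ beats x u

/-- The out-degree of a player. -/
noncomputable def outDeg {V : Type*} [Fintype V] (beats : V → V → Prop) (v : V) : ℕ :=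
  {u | beats v u}.ncard

/-- The number of directed `k`-paths originating at `v`. -/
noncomputable def kPathCount {V : Type*} [Fintype V] (beats : V → V → Prop) (k : ℕ) (v : V) : ℕ :=
  {p : Fin (k + 1) → V | Function.Injective p ∧ p 0 = v ∧
    ∀ i : Fin k, beats (p i.castSucc) (p i.succ)}.ncard

/-- A superking: a king `v` such that every player beating `v` is beaten by at
least `log₂ n` players whom `v` beats. -/
def IsSuperking {V : Type*} [Fintype V] (beats : V → V → Prop) (v : V) : Prop :=
  IsKing beats v ∧ ∀ u, beats u v →
    Real.logb 2 (Fintype.card V) ≤ ({w | beats v w ∧ beats w u}.ncard : ℝ)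

open Finset in
/-- Pairing up the players of `S` with set of winners `W`. -/
inductive PairUp {V : Type*} [DecidableEq V] (beats : V → V → Prop) : Finset V → Finset V → Prop
  | nil : PairUp beats ∅ ∅
  | cons (x y : V) (S W : Finset V) (hx : x ∉ S) (hy : y ∉ S) (hxy : x ≠ y)
      (hb : beats x y) (h : PairUp beats S W) :
      PairUp beats (insert x (insert y S)) (insert x W)

section aux
variable {V : Type*} [DecidableEq V] {beats : V → V → Prop}

lemma PairUp.subset {S W : Finset V} (h : PairUp beats S W) : W ⊆ S := by
  induction h with
  | nil => simp
  | cons x y S W hx hy hxy hb h ih =>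
    intro z hz
    have := @ih z
    simp only [Finset.mem_insert] at hz ⊢
    tauto

lemma PairUp.card {S W : Finset V} (h : PairUp beats S W) : 2 * W.card = S.card := by
  induction h with
  | nil => simp
  | cons x y S W hx hy hxy hb h ih =>
    have hxW : x ∉ W := fun hh => hx (h.subset hh)
    rw [Finset.card_insert_of_notMem hxW, Finset.card_insert_of_notMem (by simp [hxy, hx]),
      Finset.card_insert_of_notMem hy]
    omega

lemma PairUp.union {S W S' W' : Finset V} (h : PairUp beats S W) (h' : PairUp beats S' W')
    (hd : Disjoint S S') : PairUp beats (S ∪ S') (W ∪ W') := by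
  induction h with
  | nil => simpa using h'
  | cons x y S W hx hy hxy hb h ih =>
    simp only [Finset.disjoint_insert_left] at hd
    rw [Finset.insert_union, Finset.insert_union, Finset.insert_union]
    refine PairUp.cons x y _ _ ?_ ?_ hxy hb (ih hd.2.2)
    · simp [hx, hd.1]
    · simp [hy, hd.2.1]

lemma PairUp.exists_invol (hT : IsTournament beats) {S W : Finset V} (h : PairUp beats S W) :
    ∃ f : V → V, (∀ x ∈ S, f x ∈ S ∧ f x ≠ x ∧ f (f x) = x) ∧
      ∀ x, x ∈ W ↔ x ∈ S ∧ beats x (f x) := by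
  induction h with
  | nil => exact ⟨id, by simp, by simp⟩
  | cons x y S W hx hy hxy hb h ih =>
    obtain ⟨f, hf, hW⟩ := ih
    have hnb := hT.asymm _ _ hb
    refine ⟨fun z => if z = x then y else if z = y then x else f z, ?_, ?_⟩
    · intro z hz
      simp only [Finset.mem_insert] at hz ⊢
      by_cases h1 : z = x
      · subst h1; simp [hxy.symm]
      by_cases h2 : z = y
      · subst h2; simp [h1, Ne.symm h1]
      have hzS : z ∈ S := by tauto
      obtain ⟨ha, hb', hc⟩ := hf z hzS
      have h3 : f z ≠ x := fun e => hx (e ▸ ha)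
      have h4 : f z ≠ y := fun e => hy (e ▸ ha)
      simp [h1, h2, h3, h4, ha, hb', hc]
    · intro z
      simp only [Finset.mem_insert]
      by_cases h1 : z = x
      · subst h1; simp [hb]
      by_cases h2 : z = y
      · subst h2
        have : z ∉ W := fun hh => hy (h.subset hh)
        simp [h1, hnb, this]
      simp [h1, h2, hW z]

lemma PairUp.pair (hT : IsTournament beats) {S W : Finset V} {x y : V} (hxy : x ≠ y)
    (h : PairUp beats ((S.erase x).erase y) W) (hx : x ∈ S) (hy : y ∈ S) :
    ∃ c, (c = x ∨ c = y) ∧ PairUp beats S (insert c W) := by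
  have e1 : insert x (insert y ((S.erase x).erase y)) = S := by
    rw [Finset.insert_erase (by simp [hy, hxy.symm]), Finset.insert_erase hx]
  have e2 : insert y (insert x ((S.erase x).erase y)) = S := by
    rw [Finset.insert_comm, e1]
  rcases hT.total x y hxy with hb | hb
  · refine ⟨x, Or.inl rfl, ?_⟩
    have := PairUp.cons x y _ _ (by simp) (by simp) hxy hb h
    rwa [e1] at this
  · refine ⟨y, Or.inr rfl, ?_⟩
    have := PairUp.cons y x _ _ (by simp) (by simp) hxy.symm hb h
    rwa [e2] at this

lemma exists_pairUp (hT : IsTournament beats) (n : ℕ) : ∀ S : Finset V, S.card = 2 * n →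
    ∃ W, PairUp beats S W := by
  induction n with
  | zero =>
    intro S hS
    have : S = ∅ := by simpa using hS
    subst this; exact ⟨∅, PairUp.nil⟩
  | succ n ih =>
    intro S hS
    obtain ⟨x, hx, y, hy, hxy⟩ := Finset.one_lt_card.1 (show 1 < S.card by omega)
    obtain ⟨W, hW⟩ := ih ((S.erase x).erase y) (by
      rw [Finset.card_erase_of_mem (by simp [hy, hxy.symm]), Finset.card_erase_of_mem hx]; omega)
    obtain ⟨c, -, hc⟩ := hW.pair hT hxy hx hy
    exact ⟨_, hc⟩

lemma exists_pairUp_filter (hT : IsTournament beats) (P : V → Prop) [DecidablePred P] (n : ℕ) :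
    ∀ S : Finset V, S.card = 2 * n →
    ∃ W, PairUp beats S W ∧ 2 * (W.filter P).card ≤ (S.filter P).card + 1 := by
  induction n with
  | zero =>
    intro S hS
    have : S = ∅ := by simpa using hS
    subst this; exact ⟨∅, PairUp.nil, by simp⟩
  | succ n ih =>
    intro S hS
    by_cases h1 : (S.filter P).card ≤ 1
    · obtain ⟨W, hW⟩ := exists_pairUp hT _ S hS
      have := Finset.card_le_card (Finset.filter_subset_filter P hW.subset)
      exact ⟨W, hW, by omega⟩
    obtain ⟨x, hx, y, hy, hxy⟩ := Finset.one_lt_card.1 (not_le.1 h1)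
    have hx' := Finset.mem_filter.1 hx
    have hy' := Finset.mem_filter.1 hy
    obtain ⟨W, hW, hWc⟩ := ih ((S.erase x).erase y) (by
      rw [Finset.card_erase_of_mem (by simp [hy'.1, hxy.symm]),
        Finset.card_erase_of_mem hx'.1]; omega)
    obtain ⟨c, -, hc⟩ := hW.pair hT hxy hx'.1 hy'.1
    refine ⟨_, hc, ?_⟩
    rw [Finset.filter_erase, Finset.filter_erase,
      Finset.card_erase_of_mem (by simp [hy', hxy.symm]),
      Finset.card_erase_of_mem hx] at hWc
    have : ((insert c W).filter P).card ≤ (W.filter P).card + 1 := by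
      rw [Finset.filter_insert]
      split_ifs
      · exact Finset.card_insert_le _ _
      · omega
    omega

lemma exists_matching (n : ℕ) : ∀ A B : Finset V, A.card = n →
    Disjoint A B →
    ∃ A1 B1, A1 ⊆ A ∧ B1 ⊆ B ∧ A1.card = B1.card ∧ PairUp beats (A1 ∪ B1) A1 ∧
      ∀ a ∈ A \ A1, ∀ b ∈ B \ B1, ¬ beats a b := by
  induction n with
  | zero =>
    intro A B hA _
    have : A = ∅ := by simpa using hA
    subst this
    exact ⟨∅, ∅, by simp, by simp, rfl, by simpa using PairUp.nil, by simp⟩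
  | succ n ih =>
    intro A B hA hd
    by_cases h : ∃ a ∈ A, ∃ b ∈ B, beats a b
    · obtain ⟨a, ha, b, hb, hab⟩ := h
      have hAB : ∀ z, z ∈ A → z ∈ B → False := fun z h1 h2 => Finset.disjoint_left.1 hd h1 h2
      obtain ⟨A1, B1, h1, h2, h3, h4, h5⟩ := ih (A.erase a) (B.erase b)
        (by rw [Finset.card_erase_of_mem ha]; omega)
        (Finset.disjoint_of_subset_left (Finset.erase_subset _ _)
          (Finset.disjoint_of_subset_right (Finset.erase_subset _ _) hd))
      have ha1 : a ∉ A1 := fun hh => by simpa using h1 hh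
      have hb1 : b ∉ B1 := fun hh => by simpa using h2 hh
      have ha2 : a ∉ B1 := fun hh => hAB a ha (Finset.mem_of_mem_erase (h2 hh))
      have hb2 : b ∉ A1 := fun hh => hAB b (Finset.mem_of_mem_erase (h1 hh)) hb
      have hne : a ≠ b := fun e => hAB a ha (e ▸ hb)
      refine ⟨insert a A1, insert b B1, ?_, ?_, ?_, ?_, ?_⟩
      · exact Finset.insert_subset ha (h1.trans (Finset.erase_subset _ _))
      · exact Finset.insert_subset hb (h2.trans (Finset.erase_subset _ _))
      · rw [Finset.card_insert_of_notMem ha1, Finset.card_insert_of_notMem hb1, h3]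
      · rw [Finset.insert_union, Finset.union_insert]
        exact PairUp.cons a b _ _ (by simp [ha1, ha2]) (by simp [hb1, hb2]) hne hab h4
      · intro x hx y hy
        simp only [Finset.mem_sdiff, Finset.mem_insert, not_or] at hx hy
        exact h5 x (by simp [hx]) y (by simp [hy])
    · push Not at h
      refine ⟨∅, ∅, by simp, by simp, rfl, by simpa using PairUp.nil, ?_⟩
      intro a ha b hb
      exact h a (by simpa using ha) b (by simpa using hb)

lemma king_SE [DecidableRel beats] (hT : IsTournament beats) (v : V) (k : ℕ) :
    ∀ S : Finset V, S.card = 2 ^ k →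
    v ∈ S → 2 * (S.filter (fun x => beats x v)).card < S.card →
    (∀ b ∈ S, beats b v → ∃ a ∈ S, beats v a ∧ beats a b) → SEWinner beats S v := by
  induction k with
  | zero =>
    intro S hS hv _ _
    obtain ⟨w, rfl⟩ := Finset.card_eq_one.1 (by simpa using hS)
    have : v = w := by simpa using hv
    subst this
    exact SEWinner.single v
  | succ k ih =>
    intro S hS hv hB hK
    set A := S.filter (fun x => beats v x) with hAdef
    set B := S.filter (fun x => beats x v) with hBdef
    have hd : Disjoint A B := by
      rw [Finset.disjoint_left]
      intro z h1 h2
      exact hT.asymm _ _ (Finset.mem_filter.1 h1).2 (Finset.mem_filter.1 h2).2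
    have hSe : S = insert v (A ∪ B) := by
      ext z
      simp only [hAdef, hBdef, Finset.mem_insert, Finset.mem_union, Finset.mem_filter]
      constructor
      · intro hz
        by_cases e : z = v
        · exact Or.inl e
        · have := hT.total z v e
          tauto
      · rintro (rfl | h | h)
        · exact hv
        · exact h.1
        · exact h.1
    have hvAB : v ∉ A ∪ B := by simp [hAdef, hBdef, hT.irrefl]
    have hScard : S.card = A.card + B.card + 1 := by
      conv_lhs => rw [hSe]
      rw [Finset.card_insert_of_notMem hvAB, Finset.card_union_of_disjoint hd]
    obtain ⟨A1, B1, hA1, hB1, hc, hP1, hmax⟩ := exists_matching (beats := beats) _ A B rfl hd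
    have hcB := Finset.card_le_card hB1
    obtain ⟨a', ha'A, ha'A1⟩ : ∃ a ∈ A, a ∉ A1 := by
      by_contra hcon
      push Not at hcon
      have := Finset.card_le_card (show A ⊆ A1 from hcon)
      omega
    have ha'B : a' ∉ B := Finset.disjoint_left.1 hd ha'A
    have hva' : beats v a' := (Finset.mem_filter.1 ha'A).2
    have hvne : v ≠ a' := fun e => hT.irrefl v (by rw [← e] at hva'; exact hva')
    have hP2 : PairUp beats {v, a'} {v} := by
      have := PairUp.cons v a' _ _ (by simp) (by simp) hvne hva' (PairUp.nil (beats := beats))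
      simpa using this
    have hd12 : Disjoint (A1 ∪ B1) {v, a'} := by
      rw [Finset.disjoint_left]
      intro z hz hz'
      simp only [Finset.mem_insert, Finset.mem_singleton] at hz'
      rcases hz' with rfl | rfl
      · exact hvAB (Finset.union_subset_union hA1 hB1 hz)
      · rcases Finset.mem_union.1 hz with h | h
        · exact ha'A1 h
        · exact ha'B (hB1 h)
    have hP12 := hP1.union hP2 hd12
    set U := A1 ∪ B1 ∪ {v, a'} with hU
    have hUS : U ⊆ S := by
      rw [hSe]
      intro z hz
      have h1 := @hA1 z
      have h2 := @hB1 z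
      simp only [hU, Finset.mem_union, Finset.mem_insert, Finset.mem_singleton] at hz ⊢
      rcases hz with (h | h) | h | h
      · tauto
      · tauto
      · tauto
      · subst h; tauto
    have hUc := hP12.card
    have hcs := Finset.card_sdiff_add_card_eq_card hUS
    have hpow : 2 ^ (k + 1) = 2 * 2 ^ k := by ring
    obtain ⟨W', hP3, hW'⟩ := exists_pairUp_filter hT (fun x => beats x v)
      (2 ^ k - (A1 ∪ {v}).card) (S \ U) (by omega)
    have hP := hP12.union hP3 Finset.disjoint_sdiff
    rw [Finset.union_sdiff_of_subset hUS] at hP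
    have hfB : (S \ U).filter (fun x => beats x v) = B \ B1 := by
      ext z
      have h1 := @hA1 z
      have h2 : z ∈ A → z ∉ B := fun h => Finset.disjoint_left.1 hd h
      simp only [hU, hBdef, Finset.mem_filter, Finset.mem_sdiff, Finset.mem_union,
        Finset.mem_insert, Finset.mem_singleton, not_or] at h1 h2 ⊢
      constructor
      · tauto
      · rintro ⟨⟨h3, h4⟩, h5⟩
        refine ⟨⟨h3, ⟨fun h => h2 (h1 h) ⟨h3, h4⟩, h5⟩, ?_, ?_⟩, h4⟩
        · rintro rfl; exact hT.irrefl _ h4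
        · rintro rfl; exact h2 ha'A ⟨h3, h4⟩
    have hfW : (A1 ∪ {v} ∪ W').filter (fun x => beats x v) = W'.filter (fun x => beats x v) := by
      ext z
      simp only [Finset.mem_filter, Finset.mem_union, Finset.mem_singleton]
      constructor
      · rintro ⟨(h | h) | h, h4⟩
        · exact absurd h4 (hT.asymm _ _ (Finset.mem_filter.1 (hA1 h)).2)
        · subst h; exact absurd h4 (hT.irrefl _)
        · exact ⟨h, h4⟩
      · tauto
    have hWc := hP.card
    have hBB := Finset.card_sdiff_add_card_eq_card hB1
    have hAne : B.Nonempty → 0 < B1.card := by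
      rintro ⟨b, hb⟩
      by_contra hcon
      have hB0 : B1 = ∅ := Finset.card_eq_zero.1 (by omega)
      have hA0 : A1 = ∅ := Finset.card_eq_zero.1 (by omega)
      obtain ⟨a, haS, hva, hab⟩ := hK b (Finset.mem_filter.1 hb).1 (Finset.mem_filter.1 hb).2
      exact hmax a (by simp [hA0, hAdef, haS, hva]) b (by simp [hB0, hb]) hab
    obtain ⟨f, hf, hfW'⟩ := hP.exists_invol hT
    refine SEWinner.round S _ f v hf hfW' (ih _ (by omega) (by simp) ?_ ?_)
    · rw [hfW]
      rw [hfB] at hW'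
      by_cases hBn : B.Nonempty
      · have := hAne hBn
        have hk : k ≠ 0 := by
          rintro rfl
          have := hBn.card_pos
          simp at hS
          omega
        obtain ⟨m, rfl⟩ := Nat.exists_eq_succ_of_ne_zero hk
        have : 2 ^ (m + 1) = 2 * 2 ^ m := by ring
        simp only [Nat.succ_eq_add_one] at *
        omega
      · have : B.card = 0 := by
          rw [Finset.not_nonempty_iff_eq_empty.1 hBn]; rfl
        have : 0 < 2 ^ k := by positivity
        omega
    · intro b hb hbv
      have hb' : b ∈ (A1 ∪ {v} ∪ W').filter (fun x => beats x v) := Finset.mem_filter.2 ⟨hb, hbv⟩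
      rw [hfW] at hb'
      have hb2 : b ∈ B \ B1 := by
        rw [← hfB]
        exact Finset.filter_subset_filter _ hP3.subset hb'
      obtain ⟨a, haS, hva, hab⟩ := hK b (hP.subset hb) hbv
      have haA1 : a ∈ A1 := by
        by_contra hcon
        exact hmax a (by simp [hAdef, haS, hva, hcon]) b hb2 hab
      exact ⟨a, by simp [haA1], hva, hab⟩

end aux

/-- every member of the Markov set is an SE winner. -/
theorem markov_SE_winner {V : Type*} [Fintype V] [DecidableEq V]
    (beats : V → V → Prop) [DecidableRel beats] (hT : IsTournament beats)
    (k : ℕ) (hcard : Fintype.card V = 2 ^ k)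
    (Q : Matrix V V ℝ)
    (hQ : ∀ i j : V, Q i j =
      if i = j then ((outDeg beats i : ℝ) + 1) / (Fintype.card V : ℝ)
      else if beats i j then 1 / (Fintype.card V : ℝ) else 0)
    (p : V → ℝ) (hp0 : ∀ i, 0 ≤ p i) (hp1 : ∑ i, p i = 1)
    (hfix : Q.mulVec p = p)
    (i : V) (hmax : ∀ j : V, p j ≤ p i) :
    SEWinner beats Finset.univ i := by
  classical
  set n : ℝ := (Fintype.card V : ℝ) with hn
  have hnpos : 0 < n := by rw [hn, hcard]; positivity
  have hout : ∀ x, outDeg beats x = (Finset.univ.filter (fun y => beats x y)).card := by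
    intro x
    rw [outDeg, ← Set.ncard_coe_finset]
    congr 1
    ext y
    simp
  have hcnt : ∀ x, (Finset.univ.filter (fun y => beats x y)).card +
      (Finset.univ.filter (fun y => beats y x)).card + 1 = Fintype.card V := by
    intro x
    have hd : Disjoint (Finset.univ.filter (fun y => beats x y))
        (Finset.univ.filter (fun y => beats y x)) := by
      rw [Finset.disjoint_left]
      intro z h1 h2
      exact hT.asymm _ _ (Finset.mem_filter.1 h1).2 (Finset.mem_filter.1 h2).2
    have hx : x ∉ (Finset.univ.filter (fun y => beats x y)) ∪
        (Finset.univ.filter (fun y => beats y x)) := by simp [hT.irrefl]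
    rw [← Finset.card_union_of_disjoint hd, ← Finset.card_insert_of_notMem hx, ← Finset.card_univ]
    congr 1
    ext z
    have := hT.total x z
    simp only [Finset.mem_insert, Finset.mem_union, Finset.mem_filter, Finset.mem_univ, true_and,
      iff_true]
    by_cases e : z = x
    · exact Or.inl e
    · exact Or.inr (this (Ne.symm e))
  have hbal : ∀ x, ∑ y ∈ Finset.univ.filter (fun y => beats x y), p y =
      ((Finset.univ.filter (fun y => beats y x)).card : ℝ) * p x := by
    intro x
    have h1 : ∑ y, Q x y * p y = p x := congrFun hfix x
    have h2 : ∀ y, Q x y * p y = (if y = x then ((outDeg beats x : ℝ) + 1) / n * p x else 0) +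
        (if beats x y then p y else 0) / n := by
      intro y
      rw [hQ]
      by_cases e : x = y
      · subst e; simp [hT.irrefl]
      · by_cases hb : beats x y
        · simp [e, Ne.symm e, hb]; ring
        · simp [e, Ne.symm e, hb]
    simp_rw [h2] at h1
    rw [Finset.sum_add_distrib, ← Finset.sum_div, Finset.sum_ite_eq', if_pos (Finset.mem_univ _),
      ← Finset.sum_filter] at h1
    have h3 := hcnt x
    rw [hout] at h1
    have h4 : ((Finset.univ.filter (fun y => beats x y)).card : ℝ) +
      ((Finset.univ.filter (fun y => beats y x)).card : ℝ) + 1 = n := by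
      rw [hn, ← h3]; push_cast; ring
    field_simp at h1
    rw [← h4] at h1
    linarith
  have hpi : 0 < p i := by
    by_contra hcon
    have : ∑ j, p j ≤ 0 := Finset.sum_nonpos (fun j _ => (hmax j).trans (not_lt.1 hcon))
    linarith
  have hdeg : (Finset.univ.filter (fun y => beats y i)).card ≤
      (Finset.univ.filter (fun y => beats i y)).card := by
    have h1 := hbal i
    have h2 := Finset.sum_le_card_nsmul (Finset.univ.filter (fun y => beats i y)) p (p i)
      (fun j _ => hmax j)
    rw [h1, nsmul_eq_mul] at h2
    exact_mod_cast le_of_mul_le_mul_right h2 hpi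
  refine king_SE hT i k Finset.univ (by rw [Finset.card_univ, hcard]) (Finset.mem_univ _) ?_ ?_
  · have := hcnt i
    rw [Finset.card_univ]
    omega
  · intro u _ hui
    by_contra hcon
    push Not at hcon
    have hsub : insert i (Finset.univ.filter (fun y => beats i y)) ⊆
        Finset.univ.filter (fun y => beats u y) := by
      intro z hz
      simp only [Finset.mem_insert, Finset.mem_filter, Finset.mem_univ, true_and] at hz ⊢
      rcases hz with rfl | hz
      · exact hui
      · have hne : u ≠ z := by
          rintro rfl
          exact hT.asymm _ _ hui hz
        exact (hT.total u z hne).resolve_right (hcon z (Finset.mem_univ _) hz)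
    have hni : i ∉ Finset.univ.filter (fun y => beats i y) := by simp [hT.irrefl]
    have h1 := Finset.sum_le_sum_of_subset_of_nonneg hsub (fun j _ _ => hp0 j)
    rw [Finset.sum_insert hni, hbal, hbal] at h1
    have h2 := Finset.card_le_card hsub
    rw [Finset.card_insert_of_notMem hni] at h2
    have h3 : (Finset.univ.filter (fun y => beats y u)).card ≤
        (Finset.univ.filter (fun y => beats y i)).card := by
      have := hcnt i
      have := hcnt u
      omega
    have h4 : ((Finset.univ.filter (fun y => beats y u)).card : ℝ) * p u ≤
        ((Finset.univ.filter (fun y => beats y i)).card : ℝ) * p i :=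
      mul_le_mul (by exact_mod_cast h3) (hmax u) (hp0 u) (by positivity)
    linarith
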